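/- There exists a constant C > 0, depending only on d, such that for every z₀ ∈ ℝ and every δ ∈ (0,1/2), limsup_{n→∞} Σ_{α ∈ V_N ∖ V_N^δ} P(ψ_α > u_N(z₀)) ≤ C·(1 − (1 − 2δ)^d)·e^{−z₀}. -/

import Mathlib

open MeasureTheory ProbabilityTheory Real Filter Set

/-- `ℤ^d` as functions `Fin d → ℤ`. -/
abbrev Zd (d : ℕ) := Fin d → ℤ

/-- One step of the simple random walk: move from `a` by `±1` in coordinate `i`. -/
def rwStep (d : ℕ) (i : Fin d) (s : Bool) (a : Zd d) : Zd d :=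
  Function.update a i (a i + if s then 1 else -1)

/-- `m`-step transition probability of the simple random walk on `ℤ^d`. -/
noncomputable def rwP (d : ℕ) : ℕ → Zd d → Zd d → ℝ
  | 0, a, b => if a = b then 1 else 0
  | (m+1), a, b => (1 / (2 * d)) * ∑ i : Fin d, ∑ s : Bool, rwP d m (rwStep d i s a) b

/-- The Green's function `g(a,b)` of the simple random walk on `ℤ^d`. -/
noncomputable def green (d : ℕ) (a b : Zd d) : ℝ := ∑' m, rwP d m a b

open Classical in
/-- Probability that the walk started at `a` is at `b` at time `m`, having stayed in `Λ`
at all times `0,…,m`. -/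
noncomputable def rwPIn (d : ℕ) (Λ : Set (Zd d)) : ℕ → Zd d → Zd d → ℝ
  | 0, a, b => if a = b ∧ a ∈ Λ then 1 else 0
  | (m+1), a, b =>
      if a ∈ Λ then (1 / (2 * d)) * ∑ i : Fin d, ∑ s : Bool, rwPIn d Λ m (rwStep d i s a) b
      else 0

/-- Dirichlet Green's function `g_Λ(a,b)` (killed upon exiting `Λ`). -/
noncomputable def greenIn (d : ℕ) (Λ : Set (Zd d)) (a b : Zd d) : ℝ := ∑' m, rwPIn d Λ m a b

open Classical in
/-- Probability that the walk started at `a` first hits `F` at time `m`, at the point `b`. -/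
noncomputable def hitP (d : ℕ) (F : Set (Zd d)) : ℕ → Zd d → Zd d → ℝ
  | 0, a, b => if a = b ∧ b ∈ F then 1 else 0
  | (m+1), a, b =>
      if a ∈ F then 0
      else (1 / (2 * d)) * ∑ i : Fin d, ∑ s : Bool, hitP d F m (rwStep d i s a) b

open Classical in
/-- Probability that the walk started at `a` first hits `F` at time `m`, at the point `b`,
before exiting `Λ`. -/
noncomputable def hitPIn (d : ℕ) (Λ F : Set (Zd d)) : ℕ → Zd d → Zd d → ℝ
  | 0, a, b => if a = b ∧ b ∈ F ∧ b ∈ Λ then 1 else 0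
  | (m+1), a, b =>
      if a ∈ Λ ∧ a ∉ F then
        (1 / (2 * d)) * ∑ i : Fin d, ∑ s : Bool, hitPIn d Λ F m (rwStep d i s a) b
      else 0

/-- `ℙ_a(H_F < ∞, S_{H_F} = b)`, the harmonic measure of `F` seen from `a`. -/
noncomputable def hitMeas (d : ℕ) (F : Set (Zd d)) (a b : Zd d) : ℝ := ∑' m, hitP d F m a b

/-- `ℙ_a(H_F < H_{ℤ^d∖Λ}, S_{H_F} = b)`. -/
noncomputable def hitMeasIn (d : ℕ) (Λ F : Set (Zd d)) (a b : Zd d) : ℝ :=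
  ∑' m, hitPIn d Λ F m a b

/-- `(φ_a)_{a∈ℤ^d}` is a centered Gaussian field with covariance `G`: every finite linear
combination is a centered Gaussian with the prescribed variance. -/
def IsGaussianField {Ω : Type*} [MeasurableSpace Ω] (P : Measure Ω) (d : ℕ)
    (G : Zd d → Zd d → ℝ) (φ : Zd d → Ω → ℝ) : Prop :=
  (∀ a, Measurable (φ a)) ∧
    ∀ c : Zd d →₀ ℝ,
      Measure.map (fun ω => ∑ a ∈ c.support, c a * φ a ω) P =
        gaussianReal 0
          (Real.toNNReal (∑ a ∈ c.support, ∑ b ∈ c.support, c a * c b * G a b))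

/-- The centering sequence `b_N` (here `g0 = g(0)` is the variance of the field). -/
noncomputable def bN (g0 : ℝ) (N : ℕ) : ℝ :=
  Real.sqrt g0 * (Real.sqrt (2 * Real.log N) -
    (Real.log (Real.log N) + Real.log (4 * π)) / (2 * Real.sqrt (2 * Real.log N)))

/-- The scaling sequence `a_N = g(0)/b_N`. -/
noncomputable def aN (g0 : ℝ) (N : ℕ) : ℝ := g0 / bN g0 N

/-- `u_N(z) = a_N z + b_N`. -/
noncomputable def uN (g0 : ℝ) (N : ℕ) (z : ℝ) : ℝ := aN g0 N * z + bN g0 N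

/-- The box `V_N = ([0,n-1]^d) ∩ ℤ^d`, `N = n^d`. -/
noncomputable def VN (d n : ℕ) : Finset (Zd d) :=
  Fintype.piFinset fun _ => Finset.Icc (0 : ℤ) ((n : ℤ) - 1)

/-- The `ℓ∞` distance between two points of `ℤ^d`, as a real number. -/
noncomputable def distInf (d : ℕ) (a b : Zd d) : ℝ :=
  ((Finset.univ.sup fun i => (a i - b i).natAbs : ℕ) : ℝ)

open Classical in
/-- The bulk `V_N^δ` of the box `V_N`. -/
noncomputable def bulk (d n : ℕ) (δ : ℝ) : Finset (Zd d) :=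
  (VN d n).filter fun a => ∀ b : Zd d, b ∉ VN d n → δ * n < distInf d a b

/-- The rectangle `∏_i ([0,1] ∩ (lo i, hi i])` in `[0,1]^d`. -/
def rect (d : ℕ) (lo hi : Fin d → ℝ) : Set (Fin d → ℝ) :=
  {t | ∀ i, t i ∈ Set.Icc (0 : ℝ) 1 ∩ Set.Ioc (lo i) (hi i)}

open Classical in
/-- `nA ∩ V_N = {α ∈ V_N : α/n ∈ A}` for the rectangle `A = rect d lo hi`. -/
noncomputable def rectIdx (d n : ℕ) (lo hi : Fin d → ℝ) : Finset (Zd d) :=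
  (VN d n).filter fun a => (fun i => (a i : ℝ) / n) ∈ rect d lo hi

/-- `e^{-y}` for `y ∈ (-∞,+∞]`, with the convention `e^{-∞} = 0`. -/
noncomputable def expE (y : EReal) : ℝ := if y = ⊤ then 0 else Real.exp (-y.toReal)

/-- `u_N` extended to `(-∞,+∞]` by `u_N(+∞) = +∞`. -/
noncomputable def uNE (g0 : ℝ) (N : ℕ) (y : EReal) : EReal :=
  if y = ⊤ then ⊤ else ((uN g0 N y.toReal : ℝ) : EReal)

/-- `ω(R) = ∫_R e^{-z} dz` for `R ⊆ (-∞,+∞]`. -/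
noncomputable def omegaMeas (R : Set EReal) : ℝ :=
  ∫ t in {t : ℝ | (t : EReal) ∈ R}, Real.exp (-t)

/-- `R ⊆ (-∞,+∞]` is a finite union of disjoint intervals `(x,y]` with
`-∞ < x < y ≤ +∞`. -/
def IsFiniteUnionIoc (R : Set EReal) : Prop :=
  ∃ (m : ℕ) (w : Fin m → ℝ) (r : Fin m → EReal),
    (∀ l, (w l : EReal) < r l) ∧
    (Pairwise fun l l' =>
      Disjoint (Set.Ioc (w l : EReal) (r l)) (Set.Ioc (w l' : EReal) (r l'))) ∧
    R = ⋃ l, Set.Ioc ((w l : ℝ) : EReal) (r l)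

section RandomWalk

lemma rwP_nonneg (d m : ℕ) (a b : Zd d) : 0 ≤ rwP d m a b := by
  induction m generalizing a with
  | zero => simp only [rwP]; split_ifs <;> norm_num
  | succ m ih =>
    simp only [rwP]
    exact mul_nonneg (by positivity) (Finset.sum_nonneg fun i _ => Finset.sum_nonneg fun s _ => ih _)

lemma rwPIn_nonneg (d : ℕ) (Λ : Set (Zd d)) (m : ℕ) (a b : Zd d) : 0 ≤ rwPIn d Λ m a b := by
  induction m generalizing a with
  | zero => simp only [rwPIn]; split_ifs <;> norm_num
  | succ m ih =>
    simp only [rwPIn]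
    split_ifs
    · exact mul_nonneg (by positivity)
        (Finset.sum_nonneg fun i _ => Finset.sum_nonneg fun s _ => ih _)
    · exact le_rfl

lemma rwPIn_le_rwP (d : ℕ) (Λ : Set (Zd d)) (m : ℕ) (a b : Zd d) :
    rwPIn d Λ m a b ≤ rwP d m a b := by
  induction m generalizing a with
  | zero => simp only [rwPIn, rwP]; split_ifs <;> simp_all
  | succ m ih =>
    by_cases ha : a ∈ Λ
    · simp only [rwPIn, rwP, if_pos ha]
      exact mul_le_mul_of_nonneg_left
        (Finset.sum_le_sum fun i _ => Finset.sum_le_sum fun s _ => ih _) (by positivity)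
    · simp only [rwPIn, if_neg ha]
      exact rwP_nonneg d (m + 1) a b

lemma rwStep_add (d : ℕ) (i : Fin d) (s : Bool) (a c : Zd d) :
    rwStep d i s (a + c) = rwStep d i s a + c := by
  ext j
  by_cases h : j = i
  · subst h; simp [rwStep]; ring
  · simp [rwStep, Function.update_of_ne h]

lemma rwP_add_right (d m : ℕ) (a b c : Zd d) : rwP d m (a + c) (b + c) = rwP d m a b := by
  induction m generalizing a with
  | zero => simp [rwP]
  | succ m ih => simp only [rwP, rwStep_add, ih]

lemma rwP_self (d m : ℕ) (a : Zd d) : rwP d m a a = rwP d m 0 0 := by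
  simpa using rwP_add_right d m 0 0 a

/-- Partial sums of the Green's function are dominated by any nonnegative function `h` whose
image under `I - P` dominates the indicator of `b`. -/
lemma sum_rwP_le_of_superharmonic (d : ℕ) (b : Zd d) (h : Zd d → ℝ) (h0 : ∀ a, 0 ≤ h a)
    (hs : ∀ a, (if a = b then 1 else 0) +
      (1 / (2 * d)) * ∑ i : Fin d, ∑ s : Bool, h (rwStep d i s a) ≤ h a)
    (M : ℕ) (a : Zd d) : ∑ m ∈ Finset.range M, rwP d m a b ≤ h a := by
  induction M generalizing a with
  | zero => simpa using h0 a
  | succ M ih =>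
    refine le_trans ?_ (hs a)
    rw [Finset.sum_range_succ']
    simp only [rwP]
    rw [add_comm, ← Finset.mul_sum, Finset.sum_comm]
    gcongr with i _
    rw [Finset.sum_comm]
    exact Finset.sum_le_sum fun s _ => ih _

lemma one_add_rpow_neg_third_le {u : ℝ} (hu : |u| ≤ 1 / 20) :
    (1 + u) ^ (-(1 / 3) : ℝ) ≤ 1 - u / 3 + 6 / 25 * u ^ 2 := by
  obtain ⟨h1, h2⟩ := abs_le.mp hu
  have hp : 0 < 1 + u := by linarith
  have hq : 0 ≤ 1 - u / 3 + 6 / 25 * u ^ 2 := by nlinarith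
  have hc : ((1 + u) ^ (-(1 / 3) : ℝ)) ^ 3 = (1 + u)⁻¹ := by
    rw [← Real.rpow_natCast, ← Real.rpow_mul hp.le]
    norm_num [Real.rpow_neg_one]
  refine le_of_pow_le_pow_left₀ (n := 3) (by norm_num) hq ?_
  rw [hc, inv_le_iff_one_le_mul₀ hp]
  have husq : u ^ 2 ≤ 1 / 400 := by nlinarith
  have key : (1 - u / 3 + 6 / 25 * u ^ 2) ^ 3 * (1 + u) = 1 + u ^ 2 * (4 / 75 +
      (6 / 25 + 8 / 27) * u + u ^ 2 * ((3 * (6 / 25) ^ 2 - 5 / 3 * (6 / 25) - 1 / 27) +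
      (2 * (6 / 25) ^ 2 + 2 / 25) * u + u ^ 2 * (((6 / 25) ^ 3 - (6 / 25) ^ 2) +
      (6 / 25) ^ 3 * u))) := by ring
  have hE : (-1 : ℝ) ≤ ((6 / 25) ^ 3 - (6 / 25) ^ 2) + (6 / 25) ^ 3 * u := by norm_num; linarith
  have hD : (-1 : ℝ) ≤ (3 * (6 / 25) ^ 2 - 5 / 3 * (6 / 25) - 1 / 27) +
      (2 * (6 / 25) ^ 2 + 2 / 25) * u + u ^ 2 * (((6 / 25) ^ 3 - (6 / 25) ^ 2) +
      (6 / 25) ^ 3 * u) := by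
    have := mul_le_mul_of_nonneg_left hE (sq_nonneg u)
    linarith
  have hB := mul_le_mul_of_nonneg_left hD (sq_nonneg u)
  rw [key]
  exact le_add_of_nonneg_right (mul_nonneg (sq_nonneg u) (by linarith))

lemma norm_sq_rwStep (d : ℕ) (i : Fin d) (s : Bool) (a : Zd d) :
    ∑ j, ((rwStep d i s a j : ℤ) : ℝ) ^ 2 =
      ∑ j, (a j : ℝ) ^ 2 + (1 + 2 * (if s then 1 else -1) * a i) := by
  rw [← Finset.add_sum_erase _ _ (Finset.mem_univ i),
    ← Finset.add_sum_erase _ (fun j => (a j : ℝ) ^ 2) (Finset.mem_univ i)]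
  have : ∑ j ∈ Finset.univ.erase i, ((rwStep d i s a j : ℤ) : ℝ) ^ 2 =
      ∑ j ∈ Finset.univ.erase i, (a j : ℝ) ^ 2 := by
    refine Finset.sum_congr rfl fun j hj => ?_
    rw [rwStep, Function.update_of_ne (Finset.ne_of_mem_erase hj)]
  rw [this]
  cases s <;> simp [rwStep] <;> ring

lemma superharmonic_rpow (d : ℕ) (hd : 3 ≤ d) (a : Zd d) :
    (1 / (2 * d)) * ∑ i : Fin d, ∑ s : Bool,
      (∑ j, ((rwStep d i s a j : ℤ) : ℝ) ^ 2 + 10000) ^ (-(1 / 3) : ℝ) <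
    (∑ j, (a j : ℝ) ^ 2 + 10000) ^ (-(1 / 3) : ℝ) := by
  have hd' : (3 : ℝ) ≤ d := by exact_mod_cast hd
  set R : ℝ := ∑ j, (a j : ℝ) ^ 2 with hR
  have hR0 : 0 ≤ R := Finset.sum_nonneg fun j _ => sq_nonneg _
  set A : ℝ := R + 10000 with hA
  have hA0 : 0 < A := by positivity
  set F : ℝ := A ^ (-(1 / 3) : ℝ) with hF
  have hF0 : 0 < F := Real.rpow_pos_of_pos hA0 _
  have hterm : ∀ i : Fin d, ∀ s : Bool,
      (∑ j, ((rwStep d i s a j : ℤ) : ℝ) ^ 2 + 10000) ^ (-(1 / 3) : ℝ) ≤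
      F * (1 - ((1 + 2 * (if s then 1 else -1) * a i) / A) / 3 +
        6 / 25 * ((1 + 2 * (if s then 1 else -1) * a i) / A) ^ 2) := by
    intro i s
    rw [norm_sq_rwStep]
    set w : ℝ := 1 + 2 * (if s then 1 else -1) * a i with hw
    have hai : (a i : ℝ) ^ 2 ≤ R :=
      Finset.single_le_sum (f := fun j => (a j : ℝ) ^ 2) (fun j _ => sq_nonneg _)
        (Finset.mem_univ i)
    have hu : |w / A| ≤ 1 / 20 := by
      rw [abs_div, abs_of_pos hA0, div_le_iff₀ hA0]
      refine abs_le.mpr ?_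
      cases s <;> simp only [hw, if_true] <;> constructor <;>
        norm_num <;> nlinarith [sq_nonneg ((a i : ℝ) - 20), sq_nonneg ((a i : ℝ) + 20)]
    have hu1 : 0 ≤ 1 + w / A := by linarith [(abs_le.mp hu).1]
    have e : R + w + 10000 = A * (1 + w / A) := by field_simp; ring
    rw [e, Real.mul_rpow hA0.le hu1]
    exact mul_le_mul_of_nonneg_left (one_add_rpow_neg_third_le hu) hF0.le
  have hsum : ∑ i : Fin d, ∑ s : Bool,
      F * (1 - ((1 + 2 * (if s then 1 else -1) * a i) / A) / 3 +
        6 / 25 * ((1 + 2 * (if s then 1 else -1) * a i) / A) ^ 2) =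
      F * (2 * d - 2 * d / (3 * A) + 6 / 25 * (2 * d + 8 * R) / A ^ 2) := by
    have : ∀ i : Fin d, ∑ s : Bool,
      F * (1 - ((1 + 2 * (if s then 1 else -1) * a i) / A) / 3 +
        6 / 25 * ((1 + 2 * (if s then 1 else -1) * a i) / A) ^ 2) =
        F * (2 - 2 / (3 * A) + 6 / 25 * 2 / A ^ 2) + F * (6 / 25 * 8 / A ^ 2) * (a i : ℝ) ^ 2 := by
      intro i
      simp only [Fintype.sum_bool, if_true]
      norm_num
      field_simp
      ring
    simp only [this, Finset.sum_add_distrib, ← Finset.mul_sum, ← hR]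
    simp
    ring
  have hle := Finset.sum_le_sum fun i (_ : i ∈ Finset.univ) =>
    Finset.sum_le_sum fun s (_ : s ∈ Finset.univ) => hterm i s
  rw [hsum] at hle
  have hneg : - (2 * d / (3 * A)) + 6 / 25 * (2 * d + 8 * R) / A ^ 2 < 0 := by
    have : - (2 * d / (3 * A)) + 6 / 25 * (2 * d + 8 * R) / A ^ 2 =
      (6 / 25 * (2 * d + 8 * R) - 2 / 3 * d * A) / A ^ 2 := by field_simp; ring
    rw [this]
    refine div_neg_of_neg_of_pos ?_ (by positivity)
    nlinarith [mul_nonneg (sub_nonneg.mpr hd') hR0]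
  have hdp : (0 : ℝ) < 2 * d := by linarith
  rw [one_div, inv_mul_lt_iff₀ hdp]
  refine hle.trans_lt ?_
  nlinarith [mul_neg_of_pos_of_neg hF0 hneg]

lemma summable_rwP_self (d : ℕ) (hd : 3 ≤ d) : Summable fun m => rwP d m 0 0 := by
  set h : Zd d → ℝ := fun a => (∑ j, (a j : ℝ) ^ 2 + 10000) ^ (-(1 / 3) : ℝ) with hh
  set ε : ℝ := h 0 - (1 / (2 * d)) * ∑ i : Fin d, ∑ s : Bool, h (rwStep d i s 0) with hε
  have hε0 : 0 < ε := sub_pos.mpr (superharmonic_rpow d hd 0)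
  have hnn : ∀ a, 0 ≤ h a := fun a => Real.rpow_nonneg
    (add_nonneg (Finset.sum_nonneg fun j _ => sq_nonneg _) (by norm_num)) _
  refine summable_of_sum_range_le (c := h 0 / ε) (fun m => rwP_nonneg d m 0 0) fun M => ?_
  refine sum_rwP_le_of_superharmonic d 0 (fun a => h a / ε)
    (fun a => div_nonneg (hnn a) hε0.le) (fun a => ?_) M 0
  simp only [← Finset.sum_div]
  by_cases ha : a = 0
  · subst ha
    rw [if_pos rfl, ← mul_div_assoc, le_div_iff₀ hε0, add_mul, div_mul_cancel₀ _ hε0.ne']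
    linarith
  · rw [if_neg ha, zero_add, ← mul_div_assoc]
    exact div_le_div_of_nonneg_right (superharmonic_rpow d hd a).le hε0.le

lemma greenIn_self_le (d : ℕ) (hd : 3 ≤ d) (Λ : Set (Zd d)) (a : Zd d) :
    greenIn d Λ a a ≤ green d 0 0 := by
  have hle : ∀ m, rwPIn d Λ m a a ≤ rwP d m 0 0 := fun m =>
    (rwPIn_le_rwP d Λ m a a).trans_eq (rwP_self d m a)
  have hs := summable_rwP_self d hd
  exact (Summable.of_nonneg_of_le (fun m => rwPIn_nonneg d Λ m a a) hle hs).tsum_le_tsum hle hs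

lemma green_zero_pos (d : ℕ) (hd : 3 ≤ d) : 0 < green d 0 0 := by
  have h := (summable_rwP_self d hd).le_tsum 0 fun m _ => rwP_nonneg d m 0 0
  have h1 : rwP d 0 0 0 = 1 := by simp [rwP]
  rw [green]
  linarith

end RandomWalk

section Bulk

lemma mem_bulk_of_forall (d n : ℕ) (δ : ℝ) (a : Zd d) (ha : a ∈ VN d n)
    (h : ∀ i, δ * n < a i + 1 ∧ δ * n < n - a i) : a ∈ bulk d n δ := by
  classical
  rw [bulk, Finset.mem_filter]
  refine ⟨ha, fun b hb => ?_⟩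
  simp only [VN, Fintype.mem_piFinset, not_forall, Finset.mem_Icc, not_and_or, not_le] at hb ha
  obtain ⟨i, hi⟩ := hb
  have hsup : (a i - b i).natAbs ≤ Finset.univ.sup fun i => (a i - b i).natAbs :=
    Finset.le_sup (f := fun i => (a i - b i).natAbs) (Finset.mem_univ i)
  have hsup' : (((a i - b i).natAbs : ℕ) : ℝ) ≤ distInf d a b := by
    rw [distInf]; exact_mod_cast hsup
  refine lt_of_lt_of_le ?_ hsup'
  have := h i
  have hai := ha i
  rcases hi with hi | hi
  · have : a i + 1 ≤ ((a i - b i).natAbs : ℤ) := by omega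
    have : (a i : ℝ) + 1 ≤ ((a i - b i).natAbs : ℝ) := by
      simpa using (Int.cast_le (R := ℝ)).mpr this
    linarith
  · have : (n : ℤ) - a i ≤ ((a i - b i).natAbs : ℤ) := by omega
    have : (n : ℝ) - a i ≤ ((a i - b i).natAbs : ℝ) := by
      simpa using (Int.cast_le (R := ℝ)).mpr this
    linarith

lemma card_VN (d n : ℕ) : (VN d n).card = n ^ d := by
  simp [VN]

lemma le_card_bulk (d n : ℕ) {δ : ℝ} (h0 : 0 < δ) (h1 : δ < 1 / 2) :
    ((1 - 2 * δ) * n) ^ d ≤ ((bulk d n δ).card : ℝ) := by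
  have hn : (0 : ℝ) ≤ n := Nat.cast_nonneg n
  have hδn : 0 ≤ δ * n := by positivity
  have hsub : (Fintype.piFinset fun _ : Fin d => Finset.Ico ⌊δ * n⌋ ⌈n - δ * n⌉) ⊆
      bulk d n δ := by
    intro a ha
    simp only [Fintype.mem_piFinset, Finset.mem_Ico] at ha
    refine mem_bulk_of_forall d n δ a ?_ fun i => ?_
    · simp only [VN, Fintype.mem_piFinset, Finset.mem_Icc]
      intro i
      have hf : 0 ≤ ⌊δ * n⌋ := Int.floor_nonneg.mpr hδn
      have hc : ⌈n - δ * n⌉ ≤ (n : ℤ) := Int.ceil_le.mpr (by push_cast; linarith)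
      have := ha i
      omega
    · have hl : (⌊δ * n⌋ : ℝ) ≤ a i := by exact_mod_cast (ha i).1
      have hr := Int.lt_ceil.mp (ha i).2
      have := Int.lt_floor_add_one (δ * n)
      constructor <;> linarith
  have hcard := Finset.card_le_card hsub
  rw [Fintype.card_piFinset_const, Int.card_Ico] at hcard
  have hone : (1 - 2 * δ) * n ≤ ((⌈n - δ * n⌉ - ⌊δ * n⌋).toNat : ℝ) := by
    have e1 : ((⌈n - δ * n⌉ - ⌊δ * n⌋ : ℤ) : ℝ) ≤ ((⌈n - δ * n⌉ - ⌊δ * n⌋).toNat : ℝ) := by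
      exact_mod_cast Int.self_le_toNat _
    have e2 := Int.le_ceil (n - δ * n)
    have e3 := Int.floor_le (δ * n)
    push_cast at e1
    linarith
  calc ((1 - 2 * δ) * n) ^ d ≤ ((⌈n - δ * n⌉ - ⌊δ * n⌋).toNat : ℝ) ^ d :=
        pow_le_pow_left₀ (mul_nonneg (by linarith) hn) hone d
    _ ≤ ((bulk d n δ).card : ℝ) := by exact_mod_cast hcard

lemma card_VN_sdiff_bulk_le (d n : ℕ) {δ : ℝ} (h0 : 0 < δ) (h1 : δ < 1 / 2) :
    ((VN d n \ bulk d n δ).card : ℝ) ≤ (1 - (1 - 2 * δ) ^ d) * n ^ d := by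
  classical
  have hsub : bulk d n δ ⊆ VN d n := by rw [bulk]; exact Finset.filter_subset _ _
  rw [Finset.cast_card_sdiff hsub, card_VN]
  have := le_card_bulk d n h0 h1
  rw [mul_pow] at this
  push_cast
  linarith

end Bulk

section GaussianTail

lemma gaussianReal_Ioi_le {v : NNReal} (hv : v ≠ 0) {u : ℝ} (hu : 0 < u) :
    (gaussianReal 0 v (Ioi u)).toReal ≤
      √v / (√(2 * π) * u) * Real.exp (-(u ^ 2 / (2 * v))) := by
  have hv0 : (0 : ℝ) < v := by positivity
  have hint : IntegrableOn (fun x : ℝ => Real.exp (-(u / v) * x)) (Ioi u) :=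
    integrableOn_exp_mul_Ioi (by simp; positivity) u
  rw [gaussianReal_apply_eq_integral 0 hv, ENNReal.toReal_ofReal
    (setIntegral_nonneg measurableSet_Ioi fun x _ => gaussianPDFReal_nonneg _ _ _)]
  have hpt : ∀ x ∈ Ioi u, gaussianPDFReal 0 v x ≤
      (√(2 * π * v))⁻¹ * Real.exp (u ^ 2 / (2 * v)) * Real.exp (-(u / v) * x) := by
    intro x hx
    rw [gaussianPDFReal, mul_assoc (√(2 * π * v))⁻¹, ← Real.exp_add]
    gcongr
    have : u ^ 2 / (2 * v) + -(u / v) * x - -(x - 0) ^ 2 / (2 * v) = (x - u) ^ 2 / (2 * v) := by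
      field_simp; ring
    have : 0 ≤ (x - u) ^ 2 / (2 * v) := by positivity
    linarith
  refine (setIntegral_mono_on (integrable_gaussianPDFReal 0 v).integrableOn
    (hint.const_mul _) measurableSet_Ioi hpt).trans_eq ?_
  rw [integral_const_mul, integral_exp_mul_Ioi (by simp; positivity)]
  have hs : √(2 * π * v) = √(2 * π) * √v := Real.sqrt_mul (by positivity) _
  have hvv : (v : ℝ) = √v * √v := (Real.mul_self_sqrt hv0.le).symm
  have hexp : Real.exp (-(u ^ 2 / (2 * v))) =
      Real.exp (u ^ 2 / (2 * v)) * Real.exp (-(u / v) * u) := by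
    rw [← Real.exp_add]; congr 1; field_simp; ring
  rw [hexp, hs]
  have h2 : 0 < √(v : ℝ) := Real.sqrt_pos.mpr hv0
  have h3 : 0 < √(2 * π) := by positivity
  field_simp
  nlinarith [Real.sq_sqrt hv0.le]

lemma gaussianReal_Ioi_le_of_le {v : NNReal} {g : ℝ} (hg : 0 < g) (hvg : v ≤ g) {u : ℝ}
    (hu : 0 < u) :
    (gaussianReal 0 v (Ioi u)).toReal ≤
      √g / (√(2 * π) * u) * Real.exp (-(u ^ 2 / (2 * g))) := by
  by_cases hv : v = 0
  · subst hv
    rw [gaussianReal_zero_var, Measure.dirac_apply' _ measurableSet_Ioi,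
      indicator_of_notMem (by simpa using hu.le)]
    simp only [ENNReal.toReal_zero]
    positivity
  · refine (gaussianReal_Ioi_le hv hu).trans ?_
    have hv0 : (0 : ℝ) < v := by positivity
    gcongr

end GaussianTail

section Asymptotics

lemma eventually_uN_tail_le {g : ℝ} (hg : 0 < g) (z : ℝ) :
    ∀ᶠ N : ℕ in atTop, 0 < uN g N z ∧
      √g / (√(2 * π) * uN g N z) * Real.exp (-(uN g N z ^ 2 / (2 * g))) ≤
        2 * Real.exp (-z) / N := by
  have hlog : Tendsto (fun N : ℕ => Real.log N) atTop atTop :=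
    Real.tendsto_log_atTop.comp tendsto_natCast_atTop_atTop
  have hκ : ∀ᶠ x : ℝ in atTop, Real.log x + Real.log (4 * π) ≤ x := by
    have h1 := Real.isLittleO_log_id_atTop.bound (show (0 : ℝ) < 1 / 2 by norm_num)
    filter_upwards [h1, eventually_ge_atTop (2 * Real.log (4 * π)), eventually_ge_atTop 0]
      with x hx h2 h3
    simp only [id, Real.norm_eq_abs, abs_of_nonneg h3] at hx
    linarith [le_abs_self (Real.log x)]
  filter_upwards [hlog.eventually hκ, hlog.eventually_ge_atTop (1 + |4 * z|),
    eventually_ge_atTop 1] with N hk hl hN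
  have hN0 : (0 : ℝ) < N := by exact_mod_cast hN
  set l : ℝ := Real.log N with hldef
  have hl1 : 1 ≤ l := by linarith [abs_nonneg (4 * z)]
  have hl0 : 0 < l := by linarith
  set L : ℝ := √(2 * l) with hL
  have hL0 : 0 < L := by positivity
  have hLL : L ^ 2 = 2 * l := Real.sq_sqrt (by positivity)
  set κ : ℝ := Real.log l + Real.log (4 * π) with hκdef
  set s : ℝ := √g with hs
  have hs0 : 0 < s := by positivity
  have hss : s ^ 2 = g := Real.sq_sqrt hg.le
  have hbdef : bN g N = s * (L - κ / (2 * L)) := by rw [bN]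
  set b : ℝ := bN g N with hb
  have hudef : uN g N z = g / b * z + b := by rw [uN, aN]
  have hkL : κ / (2 * L) ≤ L / 4 := by
    rw [div_le_iff₀ (by positivity)]; nlinarith
  have hbL : 3 / 4 * (s * L) ≤ b := by
    rw [hbdef]; nlinarith
  have hsL : 0 < s * L := by positivity
  have hb0 : 0 < b := by linarith
  have huL : s * L / 2 ≤ uN g N z := by
    have : -(s * L / 4) ≤ g / b * z := by
      have : |g / b * z| ≤ s * L / 4 := by
        rw [abs_mul, abs_of_pos (div_pos hg hb0), div_mul_eq_mul_div, div_le_iff₀ hb0]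
        have hz : 4 * |z| ≤ l := by
          rw [abs_mul, abs_of_pos (by norm_num : (0 : ℝ) < 4)] at hl; linarith
        calc g * |z| ≤ g * (l / 4) := by gcongr; linarith
          _ ≤ s * L / 4 * (3 / 4 * (s * L)) := by
            have : s * L / 4 * (3 / 4 * (s * L)) = 3 / 8 * (g * l) := by
              rw [← hss]; linear_combination (3 / 16 * s ^ 2) * hLL
            rw [this]; nlinarith [mul_pos hg hl0]
          _ ≤ _ := by gcongr
      exact (abs_le.mp this).1
    rw [hudef]; linarith
  have hu0 : 0 < uN g N z := by linarith
  refine ⟨hu0, ?_⟩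
  have hexpo : l - κ / 2 + z ≤ uN g N z ^ 2 / (2 * g) := by
    have e1 : uN g N z ^ 2 / (2 * g) = b ^ 2 / (2 * g) + z + g * z ^ 2 / (2 * b ^ 2) := by
      rw [hudef]; field_simp; ring
    have e2 : b ^ 2 / (2 * g) = l - κ / 2 + κ ^ 2 / (8 * L ^ 2) := by
      rw [hbdef, ← hss, show l = L ^ 2 / 2 by linarith]; field_simp; ring
    have e3 : 0 ≤ g * z ^ 2 / (2 * b ^ 2) := by positivity
    have e4 : 0 ≤ κ ^ 2 / (8 * L ^ 2) := by positivity
    linarith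
  have hexp : Real.exp (-(uN g N z ^ 2 / (2 * g))) ≤ √(2 * π) * L * Real.exp (-z) / N := by
    have : Real.exp (-(l - κ / 2 + z)) = √(2 * π) * L * Real.exp (-z) / N := by
      have h1 : Real.exp (κ / 2) = √(2 * π) * L := by
        rw [hκdef, ← Real.log_mul (by positivity) (by positivity), Real.exp_half,
          Real.exp_log (by positivity), hL, ← Real.sqrt_mul (by positivity)]
        congr 1; ring
      rw [show -(l - κ / 2 + z) = κ / 2 + -z + -l by ring, Real.exp_add, Real.exp_add, h1,
        Real.exp_neg l, hldef, Real.exp_log hN0]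
      rfl
    rw [← this]
    exact Real.exp_le_exp.mpr (by linarith)
  calc s / (√(2 * π) * uN g N z) * Real.exp (-(uN g N z ^ 2 / (2 * g)))
      ≤ s / (√(2 * π) * (s * L / 2)) * (√(2 * π) * L * Real.exp (-z) / N) := by gcongr
    _ = 2 * Real.exp (-z) / N := by
      have : √(2 * π) ≠ 0 := by positivity
      field_simp

end Asymptotics

lemma IsGaussianField.map_eq {Ω : Type*} [MeasurableSpace Ω] {P : Measure Ω} {d : ℕ}
    {G : Zd d → Zd d → ℝ} {φ : Zd d → Ω → ℝ} (h : IsGaussianField P d G φ) (a : Zd d) :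
    Measure.map (φ a) P = gaussianReal 0 (Real.toNNReal (G a a)) := by
  have := h.2 (Finsupp.single a 1)
  rw [Finsupp.support_single a one_ne_zero] at this
  simpa using this

/-- The expected number of high points of the zero-boundary DGFF outside the
bulk is asymptotically at most `C(1-(1-2δ)^d)e^{-z₀}`. -/
theorem boundary_layer_negligible (d : ℕ) (hd : 3 ≤ d) :
    ∃ C > (0 : ℝ),
      ∀ (Ω : Type) (_ : MeasurableSpace Ω) (P : Measure Ω),
        IsProbabilityMeasure P →
        ∀ ψ : (n : ℕ) → Zd d → Ω → ℝ,
          (∀ n, IsGaussianField P d (greenIn d (VN d n : Set (Zd d))) (ψ n)) →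
          (∀ n, ∀ a ∉ VN d n, ∀ᵐ ω ∂P, ψ n a ω = 0) →
          ∀ (z₀ : ℝ) (δ : ℝ), 0 < δ → δ < 1 / 2 →
            Filter.limsup
              (fun n : ℕ =>
                ∑ a ∈ VN d n \ bulk d n δ,
                  (P {ω | uN (green d 0 0) (n ^ d) z₀ < ψ n a ω}).toReal)
              atTop
            ≤ C * (1 - (1 - 2 * δ) ^ d) * Real.exp (-z₀) := by
  have hg := green_zero_pos d hd
  refine ⟨2, two_pos, fun Ω _ P _ ψ hψ _ z₀ δ h0 h1 => ?_⟩
  refine limsup_le_of_le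
    (isCoboundedUnder_le_of_le atTop (x := 0) fun n => Finset.sum_nonneg fun a _ =>
      ENNReal.toReal_nonneg) ?_
  have hpow : Tendsto (fun n : ℕ => n ^ d) atTop atTop := tendsto_pow_atTop (by omega)
  filter_upwards [hpow.eventually (eventually_uN_tail_le hg z₀), eventually_ge_atTop 1]
    with n ⟨hu, htail⟩ hn
  have hn0 : (0 : ℝ) < (n : ℝ) ^ d := by positivity
  have hterm : ∀ a, (P {ω | uN (green d 0 0) (n ^ d) z₀ < ψ n a ω}).toReal ≤
      2 * Real.exp (-z₀) / (n : ℝ) ^ d := by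
    intro a
    have hset : P {ω | uN (green d 0 0) (n ^ d) z₀ < ψ n a ω} =
        gaussianReal 0 (Real.toNNReal (greenIn d (VN d n : Set (Zd d)) a a))
          (Ioi (uN (green d 0 0) (n ^ d) z₀)) := by
      rw [← (hψ n).map_eq a, Measure.map_apply ((hψ n).1 a) measurableSet_Ioi]
      rfl
    rw [hset]
    have hvar : ((Real.toNNReal (greenIn d (VN d n : Set (Zd d)) a a) : NNReal) : ℝ) ≤
        green d 0 0 := by
      rw [Real.coe_toNNReal']
      exact max_le (greenIn_self_le d hd _ a) hg.le
    refine (gaussianReal_Ioi_le_of_le hg hvar hu).trans ?_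
    simpa using htail
  calc ∑ a ∈ VN d n \ bulk d n δ, (P {ω | uN (green d 0 0) (n ^ d) z₀ < ψ n a ω}).toReal
      ≤ (VN d n \ bulk d n δ).card • (2 * Real.exp (-z₀) / (n : ℝ) ^ d) :=
        Finset.sum_le_card_nsmul _ _ _ fun a _ => hterm a
    _ ≤ ((1 - (1 - 2 * δ) ^ d) * n ^ d) * (2 * Real.exp (-z₀) / (n : ℝ) ^ d) := by
        rw [nsmul_eq_mul]
        exact mul_le_mul_of_nonneg_right (card_VN_sdiff_bulk_le d n h0 h1) (by positivity)
    _ = 2 * (1 - (1 - 2 * δ) ^ d) * Real.exp (-z₀) := by field_simp
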